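/- Let $G$ be a graph of order $n$ with minimum degree $\delta\geq 1$. Then $(n+\gamma_{st}(G))/2\geq \gamma_{\times\lceil(\delta+1)/2\rceil,t}(G)$; that is, for any signed total dominating function $f$ of $G$ the set $V_{+}=\{v:f(v)=1\}$ is a $\lceil(\delta+1)/2\rceil$-tuple total dominating set of $G$. -/

import Mathlib

open Finset

/-- A signed total dominating function of `G`. -/
def SimpleGraph.IsSTDF {V : Type*} [Fintype V] (G : SimpleGraph V) [DecidableRel G.Adj]
    (f : V → ℤ) : Prop :=
  (∀ v, f v = 1 ∨ f v = -1) ∧ ∀ v : V, 1 ≤ ∑ u ∈ G.neighborFinset v, f u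

/-- The signed total domination number of `G`. -/
noncomputable def SimpleGraph.signedTotalDominationNumber {V : Type*} [Fintype V]
    (G : SimpleGraph V) [DecidableRel G.Adj] : ℤ :=
  sInf {w : ℤ | ∃ f : V → ℤ, G.IsSTDF f ∧ w = ∑ v, f v}

/-- An open packing of `G`. -/
def SimpleGraph.IsOpenPacking {V : Type*} [Fintype V] [DecidableEq V] (G : SimpleGraph V)
    [DecidableRel G.Adj] (B : Finset V) : Prop :=
  ∀ u ∈ B, ∀ v ∈ B, u ≠ v → G.neighborFinset u ∩ G.neighborFinset v = ∅

/-- The open packing number of `G`. -/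
noncomputable def SimpleGraph.openPackingNumber {V : Type*} [Fintype V] [DecidableEq V]
    (G : SimpleGraph V) [DecidableRel G.Adj] : ℕ :=
  sSup {m : ℕ | ∃ B : Finset V, G.IsOpenPacking B ∧ B.card = m}

/-- A `k`-total limited packing of `G`. -/
def SimpleGraph.IsTotalLimitedPacking {V : Type*} [Fintype V] [DecidableEq V]
    (G : SimpleGraph V) [DecidableRel G.Adj] (k : ℕ) (L : Finset V) : Prop :=
  ∀ v : V, (G.neighborFinset v ∩ L).card ≤ k

/-- The `k`-total limited packing number of `G`. -/
noncomputable def SimpleGraph.totalLimitedPackingNumber {V : Type*} [Fintype V] [DecidableEq V]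
    (G : SimpleGraph V) [DecidableRel G.Adj] (k : ℕ) : ℕ :=
  sSup {m : ℕ | ∃ L : Finset V, G.IsTotalLimitedPacking k L ∧ L.card = m}

/-- A `k`-tuple total dominating set of `G`. -/
def SimpleGraph.IsTupleTotalDominatingSet {V : Type*} [Fintype V] [DecidableEq V]
    (G : SimpleGraph V) [DecidableRel G.Adj] (k : ℕ) (S : Finset V) : Prop :=
  ∀ v : V, k ≤ (G.neighborFinset v ∩ S).card

/-- The `k`-tuple total domination number of `G`. -/
noncomputable def SimpleGraph.tupleTotalDominationNumber {V : Type*} [Fintype V] [DecidableEq V]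
    (G : SimpleGraph V) [DecidableRel G.Adj] (k : ℕ) : ℕ :=
  sInf {m : ℕ | ∃ S : Finset V, G.IsTupleTotalDominatingSet k S ∧ S.card = m}

/-- The set of edges of `G` with one endpoint in `A` and the other in `B`. -/
def SimpleGraph.crossEdges {V : Type*} [Fintype V] [DecidableEq V] (G : SimpleGraph V)
    [DecidableRel G.Adj] (A B : Finset V) : Finset (Sym2 V) :=
  G.edgeFinset.filter (fun e => ∃ u ∈ A, ∃ w ∈ B, e = s(u, w))

/-- The set of edges of `G` with both endpoints in `A`. -/
def SimpleGraph.edgesWithin {V : Type*} [Fintype V] [DecidableEq V] (G : SimpleGraph V)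
    [DecidableRel G.Adj] (A : Finset V) : Finset (Sym2 V) :=
  G.edgeFinset.filter (fun e => ∀ v ∈ e, v ∈ A)

theorem aux_sum {V : Type*} [Fintype V] [DecidableEq V] (f : V → ℤ)
    (hf : ∀ v, f v = 1 ∨ f v = -1) (s : Finset V) :
    ∑ u ∈ s, f u = 2 * ((s ∩ Finset.univ.filter fun v => f v = 1).card : ℤ) - s.card := by
  have h1 : ∀ u ∈ s, f u = 2 * (if f u = 1 then 1 else 0) - 1 := by
    intro u _
    rcases hf u with h | h <;> simp [h]
  rw [Finset.sum_congr rfl h1, Finset.sum_sub_distrib, ← Finset.mul_sum, Finset.sum_boole]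
  have h2 : s ∩ (Finset.univ.filter fun v => f v = 1) = s.filter fun v => f v = 1 := by
    ext; simp
  rw [h2]; simp

/-- If `δ(G) ≥ 1`, then for any STDF `f` of `G`, the set `V₊` is a
`⌈(δ+1)/2⌉`-tuple total dominating set; in particular
`(n + γ_st(G))/2 ≥ γ_{×⌈(δ+1)/2⌉,t}(G)`.
(Here `⌈(δ+1)/2⌉ = (δ+1+1)/2` as natural-number division.) -/
theorem pos_set_isTupleTotalDominatingSet {V : Type*} [Fintype V] [DecidableEq V]
    (G : SimpleGraph V) [DecidableRel G.Adj] (hδ : 1 ≤ G.minDegree) :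
    (∀ f : V → ℤ, G.IsSTDF f →
        G.IsTupleTotalDominatingSet ((G.minDegree + 1 + 1) / 2)
          (Finset.univ.filter fun v => f v = 1)) ∧
      (G.tupleTotalDominationNumber ((G.minDegree + 1 + 1) / 2) : ℚ) ≤
        ((Fintype.card V : ℚ) + (G.signedTotalDominationNumber : ℚ)) / 2 := by
  have key : ∀ f : V → ℤ, G.IsSTDF f →
        G.IsTupleTotalDominatingSet ((G.minDegree + 1 + 1) / 2)
          (Finset.univ.filter fun v => f v = 1) := by
    intro f hf v
    have h1 := hf.2 v
    rw [aux_sum f hf.1, G.card_neighborFinset_eq_degree] at h1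
    have h2 := G.minDegree_le_degree v
    omega
  refine ⟨key, ?_⟩
  have hmem : G.signedTotalDominationNumber ∈
      {w : ℤ | ∃ f : V → ℤ, G.IsSTDF f ∧ w = ∑ v, f v} := by
    apply Int.csInf_mem
    · refine ⟨_, fun _ => 1, ⟨fun _ => Or.inl rfl, fun v => ?_⟩, rfl⟩
      have h2 := G.minDegree_le_degree v
      simp only [Finset.sum_const, G.card_neighborFinset_eq_degree, nsmul_eq_mul, mul_one]
      omega
    · refine ⟨-(Fintype.card V : ℤ), ?_⟩
      rintro w ⟨f, hf, rfl⟩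
      rw [aux_sum f hf.1, Finset.card_univ]
      omega
  obtain ⟨f, hf, hw⟩ := hmem
  have hle : G.tupleTotalDominationNumber ((G.minDegree + 1 + 1) / 2) ≤
      (Finset.univ.filter fun v => f v = 1).card := Nat.sInf_le ⟨_, key f hf, rfl⟩
  rw [aux_sum f hf.1, Finset.card_univ, Finset.univ_inter] at hw
  rw [hw]
  push_cast
  have : (G.tupleTotalDominationNumber ((G.minDegree + 1 + 1) / 2) : ℚ) ≤
      ((Finset.univ.filter fun v => f v = 1).card : ℚ) := by exact_mod_cast hle
  linarith
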